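/- arXiv:1912.06531 — 2 statements merged into one kernel-verified Lean document; each statement's English description precedes it below -/
import Mathlib

section
/- Let X be reflexive and assume condition (CC) holds. Let f be continuously Fréchet differentiable and weakly sequentially lower semicontinuous, and let x̄ be a local minimizer of problem (P) which is s-AKKT regular (in particular this applies if x̄ is sw- or w-AKKT regular). Then x̄ is a KKT point of (P). -/
open Filter Topology MeasureTheory

section AKKTDefs

variable {X Y : Type*} [NormedAddCommGroup X] [NormedSpace ℝ X]
  [NormedAddCommGroup Y] [NormedSpace ℝ Y]

/-- The normal cone (in the sense of convex analysis) to `C` at `x`;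
it is empty whenever `x ∉ C`. -/
def normalCone (C : Set X) (x : X) : Set (X →L[ℝ] ℝ) :=
  {v | x ∈ C ∧ ∀ z ∈ C, v (z - x) ≤ 0}

/-- The polar cone of a set `A ⊆ X`, as a subset of the topological dual. -/
def polarCone (A : Set X) : Set (X →L[ℝ] ℝ) :=
  {v | ∀ x ∈ A, v x ≤ 0}

/-- The recession cone of `S`: all `d` with `d + S ⊆ S`. -/
def recessionCone (S : Set X) : Set X :=
  {d | ∀ x ∈ S, d + x ∈ S}

/-- The radial cone (cone of feasible directions) of `S` at `x0`. -/
def radialCone (S : Set X) (x0 : X) : Set X :=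
  {d | ∃ α : ℝ, 0 ≤ α ∧ ∃ x ∈ S, d = α • (x - x0)}

/-- Weak sequential convergence `x k ⇀ x0`. -/
def WeakSeqConv (x : ℕ → X) (x0 : X) : Prop :=
  ∀ φ : X →L[ℝ] ℝ, Tendsto (fun k => φ (x k)) atTop (𝓝 (φ x0))

/-- Weak-* sequential convergence of functionals `v k →* v0`. -/
def WeakStarSeqConv (v : ℕ → X →L[ℝ] ℝ) (v0 : X →L[ℝ] ℝ) : Prop :=
  ∀ z : X, Tendsto (fun k => v k z) atTop (𝓝 (v0 z))

/-- `r^k ↓ 0`: nonnegative, monotonically decreasing, converging to `0`. -/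
def DownTo0 (r : ℕ → ℝ) : Prop :=
  (∀ k, 0 ≤ r k) ∧ Antitone r ∧ Tendsto r atTop (𝓝 0)

/-- The (Bouligand) tangent cone to `Q` at `x0`. -/
def tangentCone (Q : Set X) (x0 : X) : Set X :=
  {d | ∃ (x : ℕ → X) (t : ℕ → ℝ), (∀ k, x k ∈ Q) ∧ (∀ k, 0 < t k) ∧ Antitone t ∧
    Tendsto t atTop (𝓝 0) ∧ Tendsto x atTop (𝓝 x0) ∧
    Tendsto (fun k => (t k)⁻¹ • (x k - x0)) atTop (𝓝 d)}

/-- The weak tangent cone to `Q` at `x0`. -/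
def weakTangentCone (Q : Set X) (x0 : X) : Set X :=
  {d | ∃ (x : ℕ → X) (t : ℕ → ℝ), (∀ k, x k ∈ Q) ∧ (∀ k, 0 < t k) ∧ Antitone t ∧
    Tendsto t atTop (𝓝 0) ∧ Tendsto x atTop (𝓝 x0) ∧
    WeakSeqConv (fun k => (t k)⁻¹ • (x k - x0)) d}

/-- The Clarke tangent cone to `Q` at `x0`. -/
def clarkeTangentCone (Q : Set X) (x0 : X) : Set X :=
  {d | ∀ (x : ℕ → X) (t : ℕ → ℝ), (∀ k, x k ∈ Q) → Tendsto x atTop (𝓝 x0) →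
    (∀ k, 0 < t k) → Antitone t → Tendsto t atTop (𝓝 0) →
    ∃ dk : ℕ → X, Tendsto dk atTop (𝓝 d) ∧ ∀ k, x k + t k • dk k ∈ Q}

/-- The Fréchet (regular) normal cone to `Q` at `x0`. -/
def frechetNormalCone (Q : Set X) (x0 : X) : Set (X →L[ℝ] ℝ) :=
  {v | ∀ ε > 0, ∃ δ > 0, ∀ x ∈ Q, ‖x - x0‖ ≤ δ → v (x - x0) ≤ ε * ‖x - x0‖}

/-- A normed space is reflexive if the canonical embedding into the double dual
is surjective. -/
def IsReflexiveSpace (Z : Type*) [NormedAddCommGroup Z] [NormedSpace ℝ Z] : Prop :=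
  Function.Surjective (NormedSpace.inclusionInDoubleDual ℝ Z)

/-- The set `M(x, r)` of inexact KKT multiples:
`M(x,r) = {G'(x)*λ + μ : μ ∈ N_C(x), ⟨λ, y - G(x)⟩ ≤ r ∀ y ∈ K}`. -/
def Mset (G : X → Y) (G' : X → X →L[ℝ] Y) (C : Set X) (K : Set Y)
    (x : X) (r : ℝ) : Set (X →L[ℝ] ℝ) :=
  {v | ∃ (l : Y →L[ℝ] ℝ) (μ : X →L[ℝ] ℝ), μ ∈ normalCone C x ∧
    (∀ y ∈ K, l (y - G x) ≤ r) ∧ v = l.comp (G' x) + μ}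

/-- KKT point of problem (P). -/
def KKTPoint (f' : X → X →L[ℝ] ℝ) (G : X → Y) (G' : X → X →L[ℝ] Y)
    (C : Set X) (K : Set Y) (x0 : X) : Prop :=
  ∃ l : Y →L[ℝ] ℝ, (-(f' x0) - l.comp (G' x0)) ∈ normalCone C x0 ∧
    l ∈ normalCone K (G x0)

/-- `x0` is an s-AKKT point: there is an s-AKKT sequence with `x k → x0` in norm. -/
def sAKKTPoint (f' : X → X →L[ℝ] ℝ) (G : X → Y) (G' : X → X →L[ℝ] Y)
    (C : Set X) (K : Set Y) (x0 : X) : Prop :=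
  ∃ (x : ℕ → X) (l : ℕ → Y →L[ℝ] ℝ) (ε : ℕ → X →L[ℝ] ℝ) (r : ℕ → ℝ),
    Tendsto ε atTop (𝓝 0) ∧ DownTo0 r ∧
    (∀ k, (ε k - f' (x k) - (l k).comp (G' (x k))) ∈ normalCone C (x k)) ∧
    (∀ k, ∀ y ∈ K, (l k) (y - G (x k)) ≤ r k) ∧
    Tendsto x atTop (𝓝 x0)

/-- `x0` is a w-AKKT point: there is a w-AKKT sequence with `x k ⇀ x0` weakly. -/
def wAKKTPoint (f' : X → X →L[ℝ] ℝ) (G : X → Y) (G' : X → X →L[ℝ] Y)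
    (C : Set X) (K : Set Y) (x0 : X) : Prop :=
  ∃ (x : ℕ → X) (l : ℕ → Y →L[ℝ] ℝ) (ε : ℕ → X →L[ℝ] ℝ) (r : ℕ → ℝ),
    WeakStarSeqConv ε 0 ∧ DownTo0 r ∧
    (∀ k, (ε k - f' (x k) - (l k).comp (G' (x k))) ∈ normalCone C (x k)) ∧
    (∀ k, ∀ y ∈ K, (l k) (y - G (x k)) ≤ r k) ∧
    WeakSeqConv x x0

/-- s-AKKT regularity at `x0`. -/
def sAKKTRegular (G : X → Y) (G' : X → X →L[ℝ] Y) (C : Set X) (K : Set Y)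
    (x0 : X) : Prop :=
  ∀ (v0 : X →L[ℝ] ℝ) (x : ℕ → X) (r : ℕ → ℝ) (v : ℕ → X →L[ℝ] ℝ),
    Tendsto x atTop (𝓝 x0) → DownTo0 r → Tendsto v atTop (𝓝 v0) →
    (∀ k, v k ∈ Mset G G' C K (x k) (r k)) → v0 ∈ Mset G G' C K x0 0

/-- sw-AKKT regularity at `x0`. -/
def swAKKTRegular (G : X → Y) (G' : X → X →L[ℝ] Y) (C : Set X) (K : Set Y)
    (x0 : X) : Prop :=
  ∀ (v0 : X →L[ℝ] ℝ) (x : ℕ → X) (r : ℕ → ℝ) (v : ℕ → X →L[ℝ] ℝ),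
    Tendsto x atTop (𝓝 x0) → DownTo0 r → WeakStarSeqConv v v0 →
    (∀ k, v k ∈ Mset G G' C K (x k) (r k)) → v0 ∈ Mset G G' C K x0 0

/-- w-AKKT regularity at `x0`. -/
def wAKKTRegular (G : X → Y) (G' : X → X →L[ℝ] Y) (C : Set X) (K : Set Y)
    (x0 : X) : Prop :=
  ∀ (v0 : X →L[ℝ] ℝ) (x : ℕ → X) (r : ℕ → ℝ) (v : ℕ → X →L[ℝ] ℝ),
    WeakSeqConv x x0 → DownTo0 r → WeakStarSeqConv v v0 →
    (∀ k, v k ∈ Mset G G' C K (x k) (r k)) → v0 ∈ Mset G G' C K x0 0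

/-- Condition (CC) from the paper. -/
def CondCC (G : X → Y) (C : Set X) (K : Set Y) : Prop :=
  ∀ (x : ℕ → X) (z : X), (∀ k, x k ∈ C) → z ∈ C → WeakSeqConv x z →
    Tendsto (fun k => Metric.infDist (G (x k)) K) atTop (𝓝 0) → G z ∈ K

end AKKTDefs

lemma aux_ekeland {X : Type*} [MetricSpace X] [CompleteSpace X] (S : Set X) (hS : IsClosed S)
    (φ : X → ℝ) (hφ : Continuous φ) (m : ℝ) (hm : ∀ x ∈ S, m ≤ φ x) (δ : ℝ) (hδ : 0 < δ)
    (x0 : X) (hx0 : x0 ∈ S) :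
    ∃ x ∈ S, φ x + δ * dist x x0 ≤ φ x0 ∧ ∀ z ∈ S, φ x ≤ φ z + δ * dist z x := by
  have step : ∀ (x : X) (ε : ℝ), 0 < ε → x ∈ S → ∃ z, z ∈ S ∧ φ z + δ * dist z x ≤ φ x ∧
      ∀ w ∈ S, φ w + δ * dist w x ≤ φ x → φ z ≤ φ w + ε := by
    intro x ε hε hx
    set A : Set ℝ := φ '' {w | w ∈ S ∧ φ w + δ * dist w x ≤ φ x} with hA
    have hne : A.Nonempty := ⟨φ x, x, ⟨hx, by simp⟩, rfl⟩
    have hbd : BddBelow A := ⟨m, by rintro _ ⟨w, hw, rfl⟩; exact hm w hw.1⟩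
    obtain ⟨_, ⟨z, hz, rfl⟩, hlt⟩ := exists_lt_of_csInf_lt hne (lt_add_of_pos_right (sInf A) hε)
    refine ⟨z, hz.1, hz.2, fun w hw hw2 => ?_⟩
    have : sInf A ≤ φ w := csInf_le hbd ⟨w, ⟨hw, hw2⟩, rfl⟩
    linarith
  have step' : ∀ (n : ℕ) (x : S), ∃ z : S, φ z + δ * dist (z : X) x ≤ φ x ∧
      ∀ w ∈ S, φ w + δ * dist w x ≤ φ x → φ z ≤ φ w + 1 / ((n : ℝ) + 1) := by
    intro n x
    obtain ⟨z, h1, h2, h3⟩ := step x (1 / ((n : ℝ) + 1)) (by positivity) x.2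
    exact ⟨⟨z, h1⟩, h2, h3⟩
  choose T hT1 hT2 using step'
  let u : ℕ → S := fun n => Nat.rec (motive := fun _ => S) ⟨x0, hx0⟩ (fun n x => T n x) n
  have hu : ∀ n, u (n + 1) = T n (u n) := fun n => rfl
  have hmono : ∀ n k, φ (u (n + k)) + δ * dist (u (n + k) : X) (u n) ≤ φ (u n) := by
    intro n k
    induction k with
    | zero => simp
    | succ k ih =>
      have h1 := hT1 (n + k) (u (n + k))
      rw [← hu] at h1
      have h2 := dist_triangle (u (n + (k + 1)) : X) (u (n + k)) (u n)
      have h3 := mul_le_mul_of_nonneg_left h2 hδ.le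
      have : n + k + 1 = n + (k + 1) := by ring
      rw [this] at h1
      linarith
  have hanti : Antitone (fun n => φ (u n : X)) := by
    apply antitone_nat_of_succ_le
    intro n
    have := hmono n 1
    have h2 : 0 ≤ δ * dist (u (n + 1) : X) (u n) := by positivity
    linarith
  have hconv : ∃ l, Tendsto (fun n => φ (u n : X)) atTop (𝓝 l) :=
    ⟨_, tendsto_atTop_ciInf hanti ⟨m, by rintro _ ⟨n, rfl⟩; exact hm _ (u n).2⟩⟩
  obtain ⟨l, hl⟩ := hconv
  have hcau : CauchySeq (fun n => (u n : X)) := by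
    have hc := hl.cauchySeq
    rw [Metric.cauchySeq_iff'] at hc ⊢
    intro ε hε
    obtain ⟨N, hN⟩ := hc (δ * ε) (by positivity)
    refine ⟨N, fun n hn => ?_⟩
    have h1 := hN n hn
    obtain ⟨k, rfl⟩ := Nat.exists_eq_add_of_le hn
    have h2 := hmono N k
    rw [Real.dist_eq] at h1
    have h3 := (abs_lt.1 h1).1
    have : δ * dist (u (N + k) : X) (u N) < δ * ε := by linarith
    exact lt_of_mul_lt_mul_left this hδ.le
  obtain ⟨x, hx⟩ := cauchySeq_tendsto_of_complete hcau
  have hxS : x ∈ S := hS.mem_of_tendsto hx (Eventually.of_forall fun n => (u n).2)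
  have hφx : Tendsto (fun n => φ (u n : X)) atTop (𝓝 (φ x)) := (hφ.tendsto x).comp hx
  have hxu : ∀ n, φ x + δ * dist x (u n) ≤ φ (u n) := by
    intro n
    have h1 : Tendsto (fun k => φ (u k) + δ * dist (u k : X) (u n)) atTop
        (𝓝 (φ x + δ * dist x (u n))) :=
      hφx.add ((hx.dist tendsto_const_nhds).const_mul δ)
    refine le_of_tendsto h1 ?_
    filter_upwards [eventually_ge_atTop n] with k hk
    obtain ⟨j, rfl⟩ := Nat.exists_eq_add_of_le hk
    exact hmono n j
  refine ⟨x, hxS, hxu 0, fun z hz => ?_⟩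
  by_contra hcon
  push Not at hcon
  have hzu : ∀ n, φ z + δ * dist z (u n) ≤ φ (u n) := by
    intro n
    have h2 := mul_le_mul_of_nonneg_left (dist_triangle z x (u n)) hδ.le
    have := hxu n
    linarith
  have h1 : φ x ≤ φ z + 0 := by
    refine le_of_tendsto_of_tendsto (hφx.comp (tendsto_add_atTop_nat 1))
      (tendsto_const_nhds.add tendsto_one_div_add_atTop_nhds_zero_nat) ?_
    exact Eventually.of_forall fun n => hT2 n (u n) z hz (hzu n)
  have : 0 ≤ δ * dist z x := by positivity
  linarith

lemma aux_closed_convex {X : Type*} [NormedAddCommGroup X] [NormedSpace ℝ X]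
    (S : Set X) (hS : IsClosed S) (hc : Convex ℝ S) (x : ℕ → X) (z : X) (hx : ∀ k, x k ∈ S)
    (h : WeakSeqConv x z) : z ∈ S := by
  by_contra hz
  obtain ⟨g, u, h1, h2⟩ := geometric_hahn_banach_point_closed hc hS hz
  have := ge_of_tendsto (h g) (Eventually.of_forall fun k => (h2 _ (hx k)).le)
  linarith

lemma aux_infDist_convex {Y : Type*} [NormedAddCommGroup Y] [NormedSpace ℝ Y]
    (K : Set Y) (hne : K.Nonempty) (hc : Convex ℝ K) :
    ConvexOn ℝ Set.univ (fun y => Metric.infDist y K) := by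
  refine ⟨convex_univ, fun x _ y _ a b ha hb hab => ?_⟩
  refine le_of_forall_pos_lt_add fun ε hε => ?_
  obtain ⟨p, hp, hp'⟩ := (Metric.infDist_lt_iff hne).1 (lt_add_of_pos_right (Metric.infDist x K) hε)
  obtain ⟨q, hq, hq'⟩ := (Metric.infDist_lt_iff hne).1 (lt_add_of_pos_right (Metric.infDist y K) hε)
  have h1 := Metric.infDist_le_dist_of_mem (x := a • x + b • y) (hc hp hq ha hb hab)
  have h2 : dist (a • x + b • y) (a • p + b • q) ≤ a * dist x p + b * dist y q := by
    simp only [dist_eq_norm]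
    have : a • x + b • y - (a • p + b • q) = a • (x - p) + b • (y - q) := by module
    rw [this]
    refine (norm_add_le _ _).trans ?_
    rw [norm_smul, norm_smul, Real.norm_of_nonneg ha, Real.norm_of_nonneg hb]
  simp only [smul_eq_mul]
  have hb' : b = 1 - a := by linarith
  subst hb'
  rcases ha.eq_or_lt with h | h
  · subst h
    simp only [zero_mul, zero_add, sub_zero, one_mul] at *
    linarith
  · have := mul_lt_mul_of_pos_left hp' h
    have := mul_le_mul_of_nonneg_left hq'.le hb
    linarith

lemma aux_ultra {X : Type*} [NormedAddCommGroup X] [NormedSpace ℝ X]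
    (hrefl : IsReflexiveSpace X) (x : ℕ → X) (R : ℝ) (hR : ∀ k, ‖x k‖ ≤ R) (U : Ultrafilter ℕ) :
    ∃ z : X, ∀ φ : X →L[ℝ] ℝ, Tendsto (fun k => φ (x k)) U (𝓝 (φ z)) := by
  have hc := WeakDual.isCompact_closedBall (𝕜 := ℝ) (E := StrongDual ℝ X) 0 R
  let j : ℕ → WeakDual ℝ (StrongDual ℝ X) :=
    fun k => StrongDual.toWeakDual (NormedSpace.inclusionInDoubleDual ℝ X (x k))
  obtain ⟨w, -, hw⟩ := hc.ultrafilter_le_nhds (U.map j) (by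
    rw [le_principal_iff]
    refine Filter.mem_map.2 (Filter.univ_mem' fun k => ?_)
    have := NormedSpace.double_dual_bound ℝ X (x k)
    simpa [j] using this.trans (hR k))
  obtain ⟨z, hz⟩ := hrefl (WeakDual.toStrongDual w)
  refine ⟨z, fun φ => ?_⟩
  have h1 : Tendsto j U (𝓝 w) := hw
  have h2 := ((WeakDual.eval_continuous φ).tendsto w).comp h1
  have h3 : φ z = w φ := by
    have := congrArg (fun T => T φ) hz
    simpa using this
  rw [h3]
  exact h2

lemma aux_subseq {X : Type*} [NormedAddCommGroup X] [NormedSpace ℝ X]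
    (hrefl : IsReflexiveSpace X) (x : ℕ → X) (R : ℝ) (hR : ∀ k, ‖x k‖ ≤ R) :
    ∃ (z : X) (ψ : ℕ → ℕ), StrictMono ψ ∧ WeakSeqConv (x ∘ ψ) z := by
  set Z : Submodule ℝ X := (Submodule.span ℝ (Set.range x)).topologicalClosure with hZ
  have hxZ : ∀ k, x k ∈ Z := fun k =>
    Submodule.le_topologicalClosure _ (Submodule.subset_span ⟨k, rfl⟩)
  have hZc : IsClosed (Z : Set X) := Submodule.isClosed_topologicalClosure _
  have hsep : TopologicalSpace.IsSeparable (Z : Set X) := by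
    rw [hZ, Submodule.topologicalClosure_coe]
    exact (TopologicalSpace.IsSeparable.span (Set.countable_range x).isSeparable).closure
  obtain ⟨D, hDc, hDd⟩ := hsep
  have hDne : D.Nonempty := by
    rcases D.eq_empty_or_nonempty with h | h
    · subst h
      simp only [closure_empty] at hDd
      exact absurd (hDd (hxZ 0)) (Set.notMem_empty _)
    · exact h
  obtain ⟨d, rfl⟩ := hDc.exists_eq_range hDne
  have hφ : ∀ m, ∃ g : X →L[ℝ] ℝ, ‖g‖ ≤ 1 ∧ g (d m) = ‖d m‖ := by
    intro m
    obtain ⟨g, h1, h2⟩ := exists_dual_vector'' ℝ (d m)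
    exact ⟨g, h1, by simpa using h2⟩
  choose g hg1 hg2 using hφ
  have hsepar : ∀ z ∈ Z, (∀ m, g m z = 0) → z = 0 := by
    intro z hz h0
    by_contra hne
    have hpos : 0 < ‖z‖ := norm_pos_iff.2 hne
    obtain ⟨_, ⟨m, rfl⟩, hm⟩ := Metric.mem_closure_iff.1 (hDd hz) (‖z‖ / 2) (by positivity)
    rw [dist_eq_norm] at hm
    have h1 : ‖d m‖ ≤ ‖z - d m‖ := by
      have : g m (d m - z) = ‖d m‖ := by rw [map_sub, h0, hg2, sub_zero]
      rw [← this, norm_sub_rev]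
      refine (le_abs_self _).trans ?_
      have h5 := (g m).le_opNorm (d m - z)
      have h6 := mul_le_mul_of_nonneg_right (hg1 m) (norm_nonneg (d m - z))
      rw [Real.norm_eq_abs] at h5
      linarith
    have h2 : ‖z‖ ≤ ‖z - d m‖ + ‖d m‖ := by
      simpa using norm_add_le (z - d m) (d m)
    linarith
  have hcomp : IsCompact (Set.pi Set.univ (fun _ : ℕ => Set.Icc (-R) R)) :=
    isCompact_univ_pi fun _ => isCompact_Icc
  obtain ⟨a, -, ψ, hψ, ha⟩ := hcomp.tendsto_subseq (x := fun k m => g m (x k)) (by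
    intro k m _
    have h5 := (g m).le_opNorm (x k)
    have h6 := mul_le_mul_of_nonneg_right (hg1 m) (norm_nonneg (x k))
    have h7 := hR k
    rw [Real.norm_eq_abs] at h5
    exact abs_le.1 (by linarith))
  have ha' : ∀ m, Tendsto (fun k => g m (x (ψ k))) atTop (𝓝 (a m)) := fun m =>
    (tendsto_pi_nhds.1 ha) m
  have hU : ∀ U : Ultrafilter ℕ, ↑U ≤ (atTop : Filter ℕ) → ∃ z ∈ Z, (∀ m, g m z = a m) ∧
      ∀ φ : X →L[ℝ] ℝ, Tendsto (fun k => φ (x (ψ k))) U (𝓝 (φ z)) := by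
    intro U hUle
    obtain ⟨z, hz⟩ := aux_ultra hrefl (fun k => x (ψ k)) R (fun k => hR _) U
    refine ⟨z, ?_, fun m => ?_, hz⟩
    · by_contra hzZ
      obtain ⟨φ, u, h1, h2⟩ := geometric_hahn_banach_point_closed Z.convex hZc hzZ
      have := ge_of_tendsto (hz φ) (Eventually.of_forall fun k => (h2 _ (hxZ (ψ k))).le)
      linarith
    · exact tendsto_nhds_unique (hz (g m)) ((ha' m).mono_left hUle)
  obtain ⟨z, hzZ, hza, -⟩ := hU (hyperfilter ℕ) (by
    rw [← Nat.cofinite_eq_atTop]; exact hyperfilter_le_cofinite)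
  refine ⟨z, ψ, hψ, fun φ => ?_⟩
  rw [tendsto_iff_ultrafilter]
  intro U hUle
  obtain ⟨z', hz'Z, hz'a, hz'⟩ := hU U hUle
  have : z' - z = 0 := hsepar _ (Z.sub_mem hz'Z hzZ) fun m => by
    rw [map_sub, hza, hz'a, sub_self]
  rw [← sub_eq_zero.1 this]
  exact hz' φ

/-- Hahn-Banach sum rule. -/
lemma aux_sumrule {X Y : Type*} [NormedAddCommGroup X] [NormedSpace ℝ X]
    [NormedAddCommGroup Y] [NormedSpace ℝ Y] (C : Set X) (hC : Convex ℝ C) (x : X) (hx : x ∈ C)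
    (q : Y → ℝ) (hq : ConvexOn ℝ Set.univ q) (hqc : Continuous q) (y0 : Y)
    (A : X →L[ℝ] Y) (b : X →L[ℝ] ℝ) (δ : ℝ) (hδ : 0 ≤ δ)
    (h : ∀ z ∈ C, 0 ≤ b (z - x) + (q (y0 + A (z - x)) - q y0) + δ * ‖z - x‖) :
    ∃ (l : Y →L[ℝ] ℝ) (e : X →L[ℝ] ℝ), ‖e‖ ≤ δ ∧ (∀ y, l (y - y0) ≤ q y - q y0) ∧
      ∀ z ∈ C, 0 ≤ b (z - x) + l (A (z - x)) + e (z - x) := by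
  let P : X × Y → ℝ := fun w => q (y0 + w.2) - q y0 + δ * ‖w.1‖
  let s : Set ((X × Y) × ℝ) := {w | P w.1 < w.2}
  let t : Set ((X × Y) × ℝ) := (fun z => ((z - x, A (z - x)), -b (z - x))) '' C
  have hs1 : Convex ℝ s := by
    rintro ⟨⟨u1, v1⟩, t1⟩ h1 ⟨⟨u2, v2⟩, t2⟩ h2 α β hα hβ hαβ
    simp only [s, P, Set.mem_ofPred_eq, Prod.smul_mk, Prod.mk_add_mk, smul_eq_mul] at h1 h2 ⊢
    have hq1 := hq.2 (Set.mem_univ (y0 + v1)) (Set.mem_univ (y0 + v2)) hα hβ hαβ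
    have e1 : α • (y0 + v1) + β • (y0 + v2) = y0 + (α • v1 + β • v2) := by
      have : β = 1 - α := by linarith
      subst this
      module
    rw [e1] at hq1
    simp only [smul_eq_mul] at hq1
    have hn : ‖α • u1 + β • u2‖ ≤ α * ‖u1‖ + β * ‖u2‖ := by
      refine (norm_add_le _ _).trans ?_
      rw [norm_smul, norm_smul, Real.norm_of_nonneg hα, Real.norm_of_nonneg hβ]
    have hn2 := mul_le_mul_of_nonneg_left hn hδ
    have hβ' : β = 1 - α := by linarith
    subst hβ'
    rcases hα.eq_or_lt with h0 | h0
    · subst h0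
      simp only [zero_mul, zero_add, sub_zero, one_mul, zero_smul, one_smul] at *
      linarith
    · have := mul_lt_mul_of_pos_left h1 h0
      have := mul_le_mul_of_nonneg_left h2.le hβ
      linarith
  have hs2 : IsOpen s := by
    apply isOpen_lt
    · fun_prop
    · fun_prop
  have ht : Convex ℝ t := by
    rintro _ ⟨z1, h1, rfl⟩ _ ⟨z2, h2, rfl⟩ α β hα hβ hαβ
    refine ⟨α • z1 + β • z2, hC h1 h2 hα hβ hαβ, ?_⟩
    have e1 : α • z1 + β • z2 - x = α • (z1 - x) + β • (z2 - x) := by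
      have : β = 1 - α := by linarith
      subst this
      module
    simp only [e1, map_add, map_smul, Prod.smul_mk, Prod.mk_add_mk, smul_eq_mul]
    congr 1
    ring
  have hdisj : Disjoint s t := by
    rw [Set.disjoint_left]
    rintro _ hw ⟨z, hz, rfl⟩
    have := h z hz
    simp only [s, P, Set.mem_ofPred_eq] at hw
    linarith
  obtain ⟨F, c, hF1, hF2⟩ := geometric_hahn_banach_open hs1 hs2 ht hdisj
  have hc0 : c ≤ 0 := by
    have := hF2 _ ⟨x, hx, rfl⟩
    have h0 : F ((0, 0), 0) = 0 := map_zero F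
    simpa [h0] using this
  let σ : ℝ := F ((0, 0), 1)
  let L : X × Y →L[ℝ] ℝ := F.comp (ContinuousLinearMap.inl ℝ (X × Y) ℝ)
  have hFd : ∀ w r, F (w, r) = L w + r * σ := by
    intro w r
    have : (w, r) = (w, (0 : ℝ)) + r • (((0 : X), (0 : Y)), (1 : ℝ)) := by
      ext <;> simp
    rw [this, map_add, map_smul]
    rfl
  have hP0 : P (0, 0) = 0 := by simp [P]
  have hσt : ∀ r > 0, r * σ < c := by
    intro r hr
    have := hF1 ((0, 0), r) (by simp only [s, Set.mem_ofPred_eq, hP0]; exact hr)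
    rw [hFd] at this
    have h0 : L (0, 0) = 0 := map_zero L
    linarith
  have hσ : σ < 0 := by
    have := hσt 1 one_pos
    linarith
  have hc : c = 0 := by
    refine le_antisymm hc0 ?_
    by_contra hneg
    push Not at hneg
    have := hσt (c / σ) (div_pos_of_neg_of_neg hneg hσ)
    rw [div_mul_cancel₀ _ hσ.ne] at this
    exact lt_irrefl _ this
  subst hc
  let Λ : X × Y →L[ℝ] ℝ := (-σ)⁻¹ • L
  have hσ' : 0 < -σ := by linarith
  have hΛ : ∀ w, L w = (-σ) * Λ w := by
    intro w
    simp only [Λ, smul_apply, smul_eq_mul]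
    rw [mul_inv_cancel_left₀ hσ'.ne']
  have hΛP : ∀ w, Λ w ≤ P w := by
    intro w
    refine le_of_forall_pos_le_add fun ε hε => ?_
    have := hF1 (w, P w + ε) (by simp only [s, Set.mem_ofPred_eq]; linarith)
    rw [hFd, hΛ] at this
    by_contra hcon
    push Not at hcon
    nlinarith
  have hΛC : ∀ z ∈ C, 0 ≤ Λ (z - x, A (z - x)) + b (z - x) := by
    intro z hz
    have := hF2 _ ⟨z, hz, rfl⟩
    simp only [hFd, hΛ] at this
    by_contra hcon
    push Not at hcon
    nlinarith
  have hsplit : ∀ u v, Λ (u, v) = Λ (u, 0) + Λ (0, v) := by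
    intro u v
    rw [← map_add]
    simp
  refine ⟨Λ.comp (ContinuousLinearMap.inr ℝ X Y), Λ.comp (ContinuousLinearMap.inl ℝ X Y), ?_, ?_, ?_⟩
  · refine ContinuousLinearMap.opNorm_le_bound _ hδ fun u => ?_
    have h1 := hΛP (u, 0)
    have h2 := hΛP (-u, 0)
    have h3 : Λ (-u, 0) = -Λ (u, 0) := by
      rw [← map_neg]; simp
    simp only [P, add_zero, sub_self, zero_add, norm_neg] at h1 h2
    simp only [ContinuousLinearMap.comp_apply, ContinuousLinearMap.inl_apply, Real.norm_eq_abs]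
    exact abs_le.2 ⟨by linarith, h1⟩
  · intro y
    have h1 := hΛP (0, y - y0)
    simpa [P] using h1
  · intro z hz
    have := hΛC z hz
    rw [hsplit] at this
    simp only [ContinuousLinearMap.comp_apply, ContinuousLinearMap.inl_apply,
      ContinuousLinearMap.inr_apply]
    linarith

lemma aux_linearize {X Y : Type*} [NormedAddCommGroup X] [NormedSpace ℝ X]
    [NormedAddCommGroup Y] [NormedSpace ℝ Y] (C : Set X) (hC : Convex ℝ C) (x xbar : X)
    (hx : x ∈ C) (f : X → ℝ) (b : X →L[ℝ] ℝ) (hf : HasFDerivAt f b x)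
    (G : X → Y) (A : X →L[ℝ] Y) (hG : HasFDerivAt G A x) (D : Y → ℝ)
    (hD : ConvexOn ℝ Set.univ D) (hDl : ∀ y y', D y ≤ D y' + ‖y - y'‖)
    (k δ ρ : ℝ) (hk : 0 ≤ k) (hρ : ‖x - xbar‖ < ρ)
    (hmin : ∀ w ∈ C, ‖w - xbar‖ ≤ ρ → f x + k * D (G x) ≤ f w + k * D (G w) + δ * ‖w - x‖) :
    ∀ z ∈ C, 0 ≤ b (z - x) + (k * D (G x + A (z - x)) - k * D (G x)) + δ * ‖z - x‖ := by
  intro z hz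
  set d := z - x with hd
  have h1 : Tendsto (fun t : ℝ => t⁻¹ • (f (x + t • d) - f x)) (𝓝[>] 0) (𝓝 (b d)) :=
    (hf.hasLineDerivAt d).tendsto_slope_zero_right
  have h2 : Tendsto (fun t : ℝ => t⁻¹ • (G (x + t • d) - G x)) (𝓝[>] 0) (𝓝 (A d)) :=
    (hG.hasLineDerivAt d).tendsto_slope_zero_right
  have h3 : Tendsto (fun t : ℝ => ‖t⁻¹ • (G (x + t • d) - G x) - A d‖) (𝓝[>] 0) (𝓝 0) := by
    have := (h2.sub_const (A d)).norm
    simpa using this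
  have h4 : Tendsto (fun t : ℝ => t⁻¹ • (f (x + t • d) - f x)
      + (k * D (G x + A d) - k * D (G x)) + δ * ‖d‖
      + k * ‖t⁻¹ • (G (x + t • d) - G x) - A d‖) (𝓝[>] 0)
      (𝓝 (b d + (k * D (G x + A d) - k * D (G x)) + δ * ‖d‖ + k * 0)) :=
    ((h1.add_const _).add_const _).add (h3.const_mul k)
  rw [mul_zero, add_zero] at h4
  refine ge_of_tendsto h4 ?_
  have hnear : ∀ᶠ t : ℝ in 𝓝[>] 0, ‖x + t • d - xbar‖ < ρ := by
    have hc : Continuous (fun t : ℝ => ‖x + t • d - xbar‖) := by fun_prop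
    have := hc.tendsto 0
    simp only [zero_smul, add_zero] at this
    exact (this.eventually_lt_const hρ).filter_mono nhdsWithin_le_nhds
  have hle1 : ∀ᶠ t : ℝ in 𝓝[>] 0, t < 1 :=
    (eventually_lt_nhds one_pos).filter_mono nhdsWithin_le_nhds
  filter_upwards [hnear, hle1, self_mem_nhdsWithin] with t ht1 ht2 ht3
  have ht0 : 0 < t := ht3
  have hwC : x + t • d ∈ C := by
    have := hC hx hz (sub_nonneg.2 ht2.le) ht0.le (by ring)
    have e : (1 - t) • x + t • z = x + t • d := by rw [hd]; module
    rwa [e] at this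
  have hm := hmin _ hwC ht1.le
  have e1 : ‖x + t • d - x‖ = t * ‖d‖ := by
    rw [add_sub_cancel_left, norm_smul, Real.norm_of_nonneg ht0.le]
  rw [e1] at hm
  have hR : ‖G (x + t • d) - (G x + t • A d)‖
      = t * ‖t⁻¹ • (G (x + t • d) - G x) - A d‖ := by
    generalize G (x + t • d) = g
    have e3 : g - (G x + t • A d) = t • (t⁻¹ • (g - G x) - A d) := by
      rw [smul_sub, smul_inv_smul₀ ht0.ne']
      abel
    rw [e3, norm_smul, Real.norm_of_nonneg ht0.le]
  have hDG := hDl (G (x + t • d)) (G x + t • A d)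
  have hcv := hD.2 (Set.mem_univ (G x)) (Set.mem_univ (G x + A d)) (sub_nonneg.2 ht2.le) ht0.le
    (by ring)
  have e2 : (1 - t) • G x + t • (G x + A d) = G x + t • A d := by module
  rw [e2] at hcv
  simp only [smul_eq_mul] at hcv ⊢
  have hk1 : k * D (G (x + t • d)) ≤ k * ((1 - t) * D (G x) + t * D (G x + A d)
      + t * ‖t⁻¹ • (G (x + t • d) - G x) - A d‖) :=
    mul_le_mul_of_nonneg_left (by linarith) hk
  have key : 0 ≤ t * (t⁻¹ * (f (x + t • d) - f x) + (k * D (G x + A d) - k * D (G x)) + δ * ‖d‖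
      + k * ‖t⁻¹ • (G (x + t • d) - G x) - A d‖) := by
    have : t * (t⁻¹ * (f (x + t • d) - f x)) = f (x + t • d) - f x :=
      mul_inv_cancel_left₀ ht0.ne' _
    rw [mul_add, mul_add, mul_add, this]
    linarith
  exact nonneg_of_mul_nonneg_right key ht0

lemma aux_penalty {X Y : Type*} [NormedAddCommGroup X] [NormedSpace ℝ X]
    [NormedAddCommGroup Y] [NormedSpace ℝ Y]
    (hrefl : IsReflexiveSpace X) (f : X → ℝ) (G : X → Y) (C : Set X) (K : Set Y)
    (hCcl : IsClosed C) (hCcv : Convex ℝ C) (xbar : X) (hCC : CondCC G C K)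
    (hlsc : ∀ (x : ℕ → X) (z : X), WeakSeqConv x z →
      ∀ c : ℝ, c < f z → ∀ᶠ k in atTop, c < f (x k))
    (ρ : ℝ) (hmin : ∀ x ∈ C, G x ∈ K → ‖x - xbar‖ ≤ ρ → f xbar ≤ f x)
    (η : ℝ) (hη : 0 < η) :
    ∃ k : ℕ, ∀ x ∈ C, ‖x - xbar‖ ≤ ρ → f xbar - η ≤ f x + k * Metric.infDist (G x) K := by
  by_contra hcon
  push Not at hcon
  choose x hxC hxρ hxf using hcon
  obtain ⟨z, ψ, hψ, hz⟩ := aux_subseq hrefl x (ρ + ‖xbar‖) (fun k => by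
    have := norm_add_le (x k - xbar) xbar
    rw [sub_add_cancel] at this
    linarith [hxρ k])
  have hzC : z ∈ C := aux_closed_convex C hCcl hCcv _ z (fun k => hxC (ψ k)) hz
  have hzB : z ∈ Metric.closedBall xbar ρ :=
    aux_closed_convex _ Metric.isClosed_closedBall (convex_closedBall xbar ρ) _ z
      (fun k => by
        rw [Metric.mem_closedBall, dist_eq_norm]
        exact hxρ (ψ k)) hz
  rw [Metric.mem_closedBall, dist_eq_norm] at hzB
  have hd : Tendsto (fun k => Metric.infDist (G ((x ∘ ψ) k)) K) atTop (𝓝 0) := by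
    have hlim : Tendsto (fun k : ℕ => (f xbar - η - (f z - 1)) / ((ψ k : ℕ) : ℝ)) atTop (𝓝 0) :=
      (tendsto_const_div_atTop_nhds_zero_nat _).comp hψ.tendsto_atTop
    refine tendsto_of_tendsto_of_tendsto_of_le_of_le' tendsto_const_nhds hlim
      (Eventually.of_forall fun k => Metric.infDist_nonneg) ?_
    filter_upwards [hlsc _ z hz (f z - 1) (by linarith), eventually_gt_atTop 0] with k hk hk0
    have h1 := hxf (ψ k)
    have hpos : (0 : ℝ) < (ψ k : ℕ) := by
      exact_mod_cast hk0.trans_le (hψ.id_le k)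
    rw [le_div_iff₀ hpos, mul_comm]
    simp only [Function.comp_apply] at hk ⊢
    linarith
  have hGz := hCC _ z (fun k => hxC (ψ k)) hzC hz hd
  have hfz := hmin z hzC hGz hzB
  obtain ⟨k, hk⟩ := (hlsc _ z hz (f xbar - η) (by linarith)).exists
  have h1 := hxf (ψ k)
  have h2 : 0 ≤ ((ψ k : ℕ) : ℝ) * Metric.infDist (G (x (ψ k))) K :=
    mul_nonneg (Nat.cast_nonneg _) Metric.infDist_nonneg
  simp only [Function.comp_apply] at hk
  linarith

lemma aux_step {X Y : Type*} [NormedAddCommGroup X] [NormedSpace ℝ X] [CompleteSpace X]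
    [NormedAddCommGroup Y] [NormedSpace ℝ Y]
    (hrefl : IsReflexiveSpace X)
    (f : X → ℝ) (f' : X → X →L[ℝ] ℝ)
    (hfd : ∀ x, HasFDerivAt f (f' x) x)
    (G : X → Y) (G' : X → X →L[ℝ] Y)
    (hGd : ∀ x, HasFDerivAt G (G' x) x)
    (C : Set X) (K : Set Y) (hCcl : IsClosed C) (hCcv : Convex ℝ C)
    (hKne : K.Nonempty) (hKcv : Convex ℝ K)
    (xbar : X) (hxC : xbar ∈ C) (hxK : G xbar ∈ K)
    (hCC : CondCC G C K)
    (hlsc : ∀ (x : ℕ → X) (z : X), WeakSeqConv x z →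
      ∀ c : ℝ, c < f z → ∀ᶠ k in atTop, c < f (x k))
    (ρ : ℝ) (hρ : 0 < ρ) (hmin : ∀ x ∈ C, G x ∈ K → ‖x - xbar‖ ≤ ρ → f xbar ≤ f x) :
    ∃ (x : X) (v : X →L[ℝ] ℝ), ‖x - xbar‖ ≤ ρ ∧ ‖v - (-f' x)‖ ≤ ρ ∧ v ∈ Mset G G' C K x 0 := by
  obtain ⟨k, hk⟩ := aux_penalty hrefl f G C K hCcl hCcv xbar hCC hlsc ρ hmin (ρ * (ρ / 2))
    (by positivity)
  have hfc : Continuous f := continuous_iff_continuousAt.2 fun x => (hfd x).continuousAt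
  have hGc : Continuous G := continuous_iff_continuousAt.2 fun x => (hGd x).continuousAt
  have hDc : Continuous (fun y => Metric.infDist y K) := Metric.continuous_infDist_pt K
  have hk0 : (0 : ℝ) ≤ k := Nat.cast_nonneg k
  obtain ⟨x, ⟨hxCm, hxB⟩, hx1, hx2⟩ := aux_ekeland (C ∩ Metric.closedBall xbar ρ)
    (hCcl.inter Metric.isClosed_closedBall) (fun x => f x + k * Metric.infDist (G x) K)
    (hfc.add (continuous_const.mul (hDc.comp hGc))) (f xbar - ρ * (ρ / 2))
    (fun x hx => hk x hx.1 (by simpa [dist_eq_norm] using hx.2)) ρ hρ xbar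
    ⟨hxC, Metric.mem_closedBall_self hρ.le⟩
  rw [Metric.mem_closedBall, dist_eq_norm] at hxB
  simp only [Metric.infDist_zero_of_mem hxK, mul_zero, add_zero, dist_eq_norm] at hx1
  have hlow := hk x hxCm hxB
  have hhalf : ‖x - xbar‖ ≤ ρ / 2 := by
    have : ρ * ‖x - xbar‖ ≤ ρ * (ρ / 2) := by linarith
    exact le_of_mul_le_mul_left this hρ
  have hDcv := aux_infDist_convex K hKne hKcv
  have hlin := aux_linearize C hCcv x xbar hxCm f (f' x) (hfd x) G (G' x) (hGd x)
    (fun y => Metric.infDist y K) hDcv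
    (fun y y' => by rw [← dist_eq_norm]; exact Metric.infDist_le_infDist_add_dist)
    k ρ ρ hk0 (by linarith)
    (fun w hw hwρ => by
      have := hx2 w ⟨hw, by rwa [Metric.mem_closedBall, dist_eq_norm]⟩
      rwa [dist_eq_norm] at this)
  obtain ⟨l, e, he, hl, hC⟩ := aux_sumrule C hCcv x hxCm (fun y => k * Metric.infDist y K)
    (by simpa using hDcv.smul hk0) (continuous_const.mul hDc) (G x) (G' x) (f' x) ρ hρ.le hlin
  refine ⟨x, -f' x - e, hxB, ?_, l, -f' x - e - l.comp (G' x), ⟨hxCm, fun z hz => ?_⟩,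
    fun y hy => ?_, by abel⟩
  · have : -f' x - e - -f' x = -e := by abel
    rw [this, norm_neg]
    exact he
  · have := hC z hz
    simp only [sub_apply, neg_apply, ContinuousLinearMap.comp_apply]
    linarith
  · have h1 := hl y
    simp only [Metric.infDist_zero_of_mem hy, mul_zero] at h1
    have h2 : 0 ≤ (k : ℝ) * Metric.infDist (G x) K := mul_nonneg hk0 Metric.infDist_nonneg
    linarith

theorem stmt_7 {X Y : Type*} [NormedAddCommGroup X] [NormedSpace ℝ X] [CompleteSpace X]
    [NormedAddCommGroup Y] [NormedSpace ℝ Y] [CompleteSpace Y]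
    (hrefl : IsReflexiveSpace X)
    (f : X → ℝ) (f' : X → X →L[ℝ] ℝ)
    (hfd : ∀ x, HasFDerivAt f (f' x) x) (hfc : Continuous f')
    (G : X → Y) (G' : X → X →L[ℝ] Y)
    (hGd : ∀ x, HasFDerivAt G (G' x) x) (hGc : Continuous G')
    (C : Set X) (K : Set Y)
    (hCne : C.Nonempty) (hCcl : IsClosed C) (hCcv : Convex ℝ C)
    (hKne : K.Nonempty) (hKcl : IsClosed K) (hKcv : Convex ℝ K)
    (xbar : X) (hxC : xbar ∈ C) (hxK : G xbar ∈ K)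
    (hCC : CondCC G C K)
    (hlsc : ∀ (x : ℕ → X) (z : X), WeakSeqConv x z →
      ∀ c : ℝ, c < f z → ∀ᶠ k in atTop, c < f (x k))
    (hmin : ∃ ε > (0 : ℝ), ∀ x ∈ C, G x ∈ K → ‖x - xbar‖ ≤ ε → f xbar ≤ f x)
    (hreg : sAKKTRegular G G' C K xbar) :
    KKTPoint f' G G' C K xbar := by
  obtain ⟨ε, hε, hmin⟩ := hmin
  have hρ : ∀ n : ℕ, 0 < ε * (1 / ((n : ℝ) + 1)) := fun n => by positivity
  have hρε : ∀ n : ℕ, ε * (1 / ((n : ℝ) + 1)) ≤ ε := fun n => by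
    have : 1 / ((n : ℝ) + 1) ≤ 1 := by
      rw [div_le_one (by positivity)]
      linarith [Nat.cast_nonneg (α := ℝ) n]
    nlinarith
  have hρ0 : Tendsto (fun n : ℕ => ε * (1 / ((n : ℝ) + 1))) atTop (𝓝 0) := by
    simpa using tendsto_one_div_add_atTop_nhds_zero_nat.const_mul ε
  choose x v hx hv hM using fun n : ℕ =>
    aux_step hrefl f f' hfd G G' hGd C K hCcl hCcv hKne hKcv xbar hxC hxK hCC hlsc _ (hρ n)
      (fun x h1 h2 h3 => hmin x h1 h2 (h3.trans (hρε n)))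
  have hxt : Tendsto x atTop (𝓝 xbar) := by
    rw [tendsto_iff_norm_sub_tendsto_zero]
    exact squeeze_zero (fun n => norm_nonneg _) hx hρ0
  have hvt : Tendsto v atTop (𝓝 (-f' xbar)) := by
    have h1 : Tendsto (fun n => v n - (-f' (x n))) atTop (𝓝 0) :=
      squeeze_zero_norm hv hρ0
    have h2 : Tendsto (fun n => -f' (x n)) atTop (𝓝 (-f' xbar)) :=
      ((hfc.tendsto xbar).comp hxt).neg
    simpa using h1.add h2
  obtain ⟨l, μ, hμ, hl, heq⟩ := hreg (-f' xbar) x (fun _ => 0) v hxt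
    ⟨fun _ => le_rfl, antitone_const, tendsto_const_nhds⟩ hvt hM
  refine ⟨l, ?_, hxK, hl⟩
  have : -f' xbar - l.comp (G' xbar) = μ := by rw [heq]; abel
  rw [this]
  exact hμ
end

section
/- Assume that Robinson's constraint qualification is satisfied at a feasible point x̄ ∈ F of problem (P), i.e., Y = G'(x̄) R_C(x̄) − R_K(G(x̄)). Then x̄ is sw-AKKT regular (and thus s-AKKT regular). -/
open Filter Topology MeasureTheory

theorem aux_pair {Z : Type*} [NormedAddCommGroup Z] [NormedSpace ℝ Z]
    (U : Filter ℕ) (l : ℕ → Z →L[ℝ] ℝ) (l0 : Z →L[ℝ] ℝ) (R : ℝ)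
    (hR : ∀ᶠ k in U, ‖l k‖ ≤ R)
    (hl : ∀ z, Tendsto (fun k => l k z) U (𝓝 (l0 z)))
    (w : ℕ → Z) (w0 : Z) (hw : Tendsto w U (𝓝 w0)) :
    Tendsto (fun k => l k (w k)) U (𝓝 (l0 w0)) := by
  have h1 : Tendsto (fun k => R * ‖w k - w0‖) U (𝓝 0) := by
    have := (tendsto_iff_norm_sub_tendsto_zero.1 hw).const_mul R
    simpa using this
  have h2 : Tendsto (fun k => l k (w k - w0)) U (𝓝 0) := by
    refine squeeze_zero_norm' ?_ h1
    filter_upwards [hR] with k hk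
    exact (l k).le_of_opNorm_le hk _
  have h3 := h2.add (hl w0)
  simpa using h3

theorem aux_ws_bdd {Z : Type*} [NormedAddCommGroup Z] [NormedSpace ℝ Z] [CompleteSpace Z]
    (v : ℕ → Z →L[ℝ] ℝ) (v0 : Z →L[ℝ] ℝ) (h : WeakStarSeqConv v v0) :
    ∃ R, ∀ k, ‖v k‖ ≤ R := by
  apply banach_steinhaus
  intro z
  obtain ⟨B, hB⟩ := (h z).norm.bddAbove_range
  exact ⟨B, fun k => hB ⟨k, rfl⟩⟩

theorem aux_alaoglu {Z : Type*} [NormedAddCommGroup Z] [NormedSpace ℝ Z]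
    (U : Ultrafilter ℕ) (l : ℕ → Z →L[ℝ] ℝ) (R : ℝ)
    (hR : ∀ᶠ k in (U : Filter ℕ), ‖l k‖ ≤ R) :
    ∃ l0 : Z →L[ℝ] ℝ, ∀ z, Tendsto (fun k => l k z) U (𝓝 (l0 z)) := by
  have hc := WeakDual.isCompact_closedBall (𝕜 := ℝ) (0 : StrongDual ℝ Z) R
  obtain ⟨a, -, ha⟩ := hc.ultrafilter_le_nhds (U.map (fun k => StrongDual.toWeakDual (l k)))
    (by
      rw [le_principal_iff]
      change ∀ᶠ k in (U : Filter ℕ), _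
      filter_upwards [hR] with k hk
      simpa using hk)
  refine ⟨WeakDual.toStrongDual a, fun z => ?_⟩
  exact ((WeakDual.eval_continuous z).tendsto a).comp (show Tendsto _ _ _ from ha)

theorem aux_sw {X Y : Type*} [NormedAddCommGroup X] [NormedSpace ℝ X] [CompleteSpace X]
    [NormedAddCommGroup Y] [NormedSpace ℝ Y] [CompleteSpace Y]
    (G : X → Y) (G' : X → X →L[ℝ] Y)
    (hGd : ∀ x, HasFDerivAt G (G' x) x) (hGc : Continuous G')
    (C : Set X) (K : Set Y)
    (xbar : X) (hxC : xbar ∈ C)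
    (hRCQ : ∀ y : Y, ∃ d ∈ radialCone C xbar, ∃ w ∈ radialCone K (G xbar),
      y = G' xbar d - w) :
    swAKKTRegular G G' C K xbar := by
  intro v0 x r v hx hr hv hM
  choose l μ hμ hl hvk using hM
  obtain ⟨V, hV⟩ := aux_ws_bdd v v0 hv
  have hV0 : 0 ≤ V := (norm_nonneg _).trans (hV 0)
  have hG : Tendsto (fun k => G (x k)) atTop (𝓝 (G xbar)) :=
    (hGd xbar).continuousAt.tendsto.comp hx
  have hG' : Tendsto (fun k => G' (x k)) atTop (𝓝 (G' xbar)) :=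
    (hGc.tendsto xbar).comp hx
  have hap : ∀ c : X, Tendsto (fun k => G' (x k) (c - x k)) atTop (𝓝 (G' xbar (c - xbar))) :=
    fun c => (isBoundedBilinearMap_apply (𝕜 := ℝ) (E := X) (F := Y)).continuous.tendsto
      (G' xbar, c - xbar) |>.comp (hG'.prodMk_nhds (hx.const_sub c))
  have hvc : ∀ c : X, Tendsto (fun k => v k (c - x k)) atTop (𝓝 (v0 (c - xbar))) :=
    fun c => aux_pair atTop v v0 V (Eventually.of_forall hV) hv _ _ (tendsto_const_nhds.sub hx)
  set ε : ℕ → ℝ := fun k => ‖G (x k) - G xbar‖ + ‖G' xbar - G' (x k)‖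
    + ‖G' (x k) (xbar - x k)‖ with hε
  have hε0 : ∀ k, 0 ≤ ε k := fun k => by positivity
  have hεt : Tendsto ε atTop (𝓝 0) := by
    have h1 := (hG.sub_const (G xbar)).norm
    have h2 := (hG'.const_sub (G' xbar)).norm
    have h3 := (hap xbar).norm
    simpa [hε] using (h1.add h2).add h3
  set e : ℕ → ℝ := fun k => 1 + ε k * ‖l k‖ with he
  have he1 : ∀ k, 1 ≤ e k := fun k => by
    have := mul_nonneg (hε0 k) (norm_nonneg (l k)); simp only [he]; linarith
  have hepos : ∀ k, 0 < e k := fun k => by linarith [he1 k]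
  -- pointwise lower bound
  have key : ∀ y : Y, ∃ B : ℝ, ∀ k, - (B * e k) ≤ l k y := by
    intro y
    obtain ⟨d, ⟨α, hα, c, hc, rfl⟩, w, ⟨β, hβ, z, hz, rfl⟩, rfl⟩ := hRCQ y
    obtain ⟨B1, hB1⟩ := (hvc c).norm.bddAbove_range
    refine ⟨α * (B1 + (‖c - xbar‖ + 1)) + β * (r 0 + 1), fun k => ?_⟩
    have hB1k : ‖v k (c - x k)‖ ≤ B1 := hB1 ⟨k, rfl⟩
    have hB10 : 0 ≤ B1 := (norm_nonneg _).trans hB1k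
    have hln := norm_nonneg (l k)
    have heps : ε k * ‖l k‖ ≤ e k := by simp only [he]; linarith
    have hz1 : l k (z - G xbar) ≤ (r 0 + 1) * e k := by
      have h1 : l k (z - G xbar) = l k (z - G (x k)) + l k (G (x k) - G xbar) := by
        rw [← map_add]; congr 1; abel
      have h2 := hl k z hz
      have h3 : r k ≤ r 0 := hr.2.1 (Nat.zero_le k)
      have h4 := (le_abs_self _).trans ((l k).le_opNorm (G (x k) - G xbar))
      have h5 : ‖l k‖ * ‖G (x k) - G xbar‖ ≤ ε k * ‖l k‖ := by
        rw [mul_comm]; gcongr; simp only [hε]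
        linarith [norm_nonneg (G' xbar - G' (x k)), norm_nonneg (G' (x k) (xbar - x k))]
      nlinarith [hr.1 0, he1 k]
    have hc1 : -((B1 + (‖c - xbar‖ + 1)) * e k) ≤ l k (G' xbar (c - xbar)) := by
      have h1 : l k (G' xbar (c - xbar)) = l k (G' (x k) (c - x k))
          + l k ((G' xbar - G' (x k)) (c - xbar)) - l k (G' (x k) (xbar - x k)) := by
        simp only [map_sub, sub_apply]; ring
      have h2 : v k (c - x k) = l k (G' (x k) (c - x k)) + μ k (c - x k) := by
        rw [hvk k]; simp
      have h3 := (hμ k).2 c hc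
      have h4 := (neg_abs_le _).trans' (neg_le_neg ((l k).le_opNorm ((G' xbar - G' (x k)) (c - xbar))))
      have h4' := (G' xbar - G' (x k)).le_opNorm (c - xbar)
      have h5 := (le_abs_self _).trans ((l k).le_opNorm (G' (x k) (xbar - x k)))
      have h6 := (neg_abs_le (v k (c - x k))).trans' (neg_le_neg hB1k)
      have h7 : ‖l k‖ * ‖(G' xbar - G' (x k)) (c - xbar)‖ ≤ ‖c - xbar‖ * e k := by
        calc _ ≤ ‖l k‖ * (‖G' xbar - G' (x k)‖ * ‖c - xbar‖) := by gcongr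
          _ ≤ ‖l k‖ * (ε k * ‖c - xbar‖) := by
            gcongr; simp only [hε]
            linarith [norm_nonneg (G (x k) - G xbar), norm_nonneg (G' (x k) (xbar - x k))]
          _ = ‖c - xbar‖ * (ε k * ‖l k‖) := by ring
          _ ≤ _ := by gcongr
      have h8 : ‖l k‖ * ‖G' (x k) (xbar - x k)‖ ≤ e k := by
        refine le_trans ?_ heps
        rw [mul_comm]; gcongr; simp only [hε]
        linarith [norm_nonneg (G (x k) - G xbar), norm_nonneg (G' xbar - G' (x k))]
      nlinarith [he1 k]
    have e1 : l k (G' xbar (α • (c - xbar)) - β • (z - G xbar))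
        = α * l k (G' xbar (c - xbar)) - β * l k (z - G xbar) := by
      simp only [map_sub, map_smul, smul_eq_mul]
    rw [e1]
    have := mul_le_mul_of_nonneg_left hc1 hα
    have := mul_le_mul_of_nonneg_left hz1 hβ
    linarith
  have hbs : ∃ D, ∀ k, ‖(e k)⁻¹ • l k‖ ≤ D := by
    apply banach_steinhaus
    intro y
    obtain ⟨B, hB⟩ := key y
    obtain ⟨B', hB'⟩ := key (-y)
    refine ⟨max B B', fun k => ?_⟩
    have h1 := hB k
    have h2 := hB' k
    rw [map_neg] at h2
    rw [smul_apply, smul_eq_mul, Real.norm_eq_abs, abs_mul,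
      abs_of_pos (inv_pos.2 (hepos k)), inv_mul_le_iff₀ (hepos k), abs_le]
    have h3 := mul_le_mul_of_nonneg_right (le_max_left B B') (hepos k).le
    have h4 := mul_le_mul_of_nonneg_right (le_max_right B B') (hepos k).le
    constructor <;> linarith
  obtain ⟨D, hD⟩ := hbs
  have hD0 : 0 ≤ D := (norm_nonneg _).trans (hD 0)
  have hlb : ∀ᶠ k in atTop, ‖l k‖ ≤ 2 * D := by
    have h1 : Tendsto (fun k => D * ε k) atTop (𝓝 0) := by simpa using hεt.const_mul D
    filter_upwards [h1.eventually (ge_mem_nhds (show (0:ℝ) < 1/2 by norm_num))] with k hk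
    have h2 := hD k
    rw [norm_smul, norm_inv, Real.norm_of_nonneg (hepos k).le, inv_mul_le_iff₀ (hepos k)] at h2
    simp only [he] at h2
    nlinarith [norm_nonneg (l k)]
  let U : Ultrafilter ℕ := Ultrafilter.of atTop
  have hU : (U : Filter ℕ) ≤ atTop := Ultrafilter.of_le atTop
  obtain ⟨l0, hl0⟩ := aux_alaoglu U l (2 * D) (hU hlb)
  refine ⟨l0, v0 - l0.comp (G' xbar), ⟨hxC, fun c hc => ?_⟩, fun z hz => ?_, by abel⟩
  · have h1 := aux_pair U l l0 (2 * D) (hU hlb) hl0 _ _ ((hap c).mono_left hU)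
    have h2 := ((hvc c).mono_left hU).sub h1
    refine le_of_tendsto h2 (Eventually.of_forall fun k => ?_)
    have h3 := (hμ k).2 c hc
    rw [hvk k]
    simpa using h3
  · have h1 := aux_pair U l l0 (2 * D) (hU hlb) hl0 _ _ ((hG.mono_left hU).const_sub z)
    exact le_of_tendsto_of_tendsto h1 (hr.2.2.mono_left hU)
      (Eventually.of_forall fun k => hl k z hz)

theorem stmt_10 {X Y : Type*} [NormedAddCommGroup X] [NormedSpace ℝ X] [CompleteSpace X]
    [NormedAddCommGroup Y] [NormedSpace ℝ Y] [CompleteSpace Y]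
    (G : X → Y) (G' : X → X →L[ℝ] Y)
    (hGd : ∀ x, HasFDerivAt G (G' x) x) (hGc : Continuous G')
    (C : Set X) (K : Set Y)
    (hCne : C.Nonempty) (hCcl : IsClosed C) (hCcv : Convex ℝ C)
    (hKne : K.Nonempty) (hKcl : IsClosed K) (hKcv : Convex ℝ K)
    (xbar : X) (hxC : xbar ∈ C) (hxK : G xbar ∈ K)
    (hRCQ : ∀ y : Y, ∃ d ∈ radialCone C xbar, ∃ w ∈ radialCone K (G xbar),
      y = G' xbar d - w) :
    swAKKTRegular G G' C K xbar ∧ sAKKTRegular G G' C K xbar := by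
  have h := aux_sw G G' hGd hGc C K xbar hxC hRCQ
  refine ⟨h, fun v0 x r v hx hr hv hM => h v0 x r v hx hr (fun z => ?_) hM⟩
  exact ((ContinuousLinearMap.apply ℝ ℝ z).continuous.tendsto v0).comp hv
end
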